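/- The (n+1)-dimensional volume of C_n^0 (the convex hull of the graph of x_1⋯x_n on [0,b]) equals (∏_{i=1}^n b_i^2)(n! - 1)/(n+1)!. -/

import Mathlib

open MeasureTheory Set

lemma aux_lint (n : ℕ) (c t C : ℝ) (hc : 0 < c) (ht : 0 < t) (hC : 0 ≤ C) :
    ∫⁻ s in Ico 0 (c * t), ENNReal.ofReal (C * (t - s / c) ^ n) =
      ENNReal.ofReal (C * c * t ^ (n + 1) / (n + 1)) := by
  have hct : 0 ≤ c * t := by positivity
  rw [setLIntegral_congr Ico_ae_eq_Ioc, ← ofReal_integral_eq_lintegral_ofReal]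
  · congr 1
    rw [← intervalIntegral.integral_of_le hct, intervalIntegral.integral_const_mul]
    have h := intervalIntegral.integral_comp_sub_div (a := 0) (b := c * t)
      (fun x : ℝ => x ^ n) hc.ne' t
    rw [h, integral_pow]
    have : c * t / c = t := by field_simp
    simp [this]
    ring
  · have : Continuous (fun s : ℝ => C * (t - s / c) ^ n) := by fun_prop
    exact (this.integrableOn_Icc (a := 0) (b := c * t)).mono_set Ioc_subset_Icc_self
  · filter_upwards [ae_restrict_mem measurableSet_Ioc] with s hs
    have : s / c ≤ t := by rw [div_le_iff₀ hc]; linarith [hs.2]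
    have : 0 ≤ t - s / c := by linarith
    positivity

lemma simplex_meas (n : ℕ) (b : Fin n → ℝ) (t : ℝ) :
    MeasurableSet {w : Fin n → ℝ | (∀ i, 0 ≤ w i) ∧ ∑ i, w i / b i < t} := by
  simp only [Set.ofPred_and, Set.ofPred_forall]
  refine MeasurableSet.inter ?_ ?_
  · exact MeasurableSet.iInter fun i => measurableSet_le measurable_const (measurable_pi_apply i)
  · exact measurableSet_lt (by fun_prop) measurable_const

lemma simplex_vol (n : ℕ) : ∀ (b : Fin n → ℝ) (_ : ∀ i, 0 < b i) (t : ℝ) (_ : 0 < t),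
    volume {w : Fin n → ℝ | (∀ i, 0 ≤ w i) ∧ ∑ i, w i / b i < t} =
      ENNReal.ofReal ((∏ i, b i) * t ^ n / n.factorial) := by
  induction n with
  | zero =>
    intro b hb t ht
    simp [ht, volume_pi]
  | succ n ih =>
    intro b hb t ht
    have mp := volume_preserving_piFinSuccAbove (fun _ : Fin (n + 1) => ℝ) 0
    have hS : {w : Fin (n + 1) → ℝ | (∀ i, 0 ≤ w i) ∧ ∑ i, w i / b i < t} =
        (MeasurableEquiv.piFinSuccAbove (fun _ : Fin (n + 1) => ℝ) 0) ⁻¹'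
        {p : ℝ × (Fin n → ℝ) | (0 ≤ p.1 ∧ ∀ i, 0 ≤ p.2 i) ∧
          p.1 / b 0 + ∑ i, p.2 i / b i.succ < t} := by
      ext w
      simp [Fin.forall_fin_succ, Fin.sum_univ_succ, MeasurableEquiv.piFinSuccAbove, Fin.tail]
    have hm : MeasurableSet {p : ℝ × (Fin n → ℝ) | (0 ≤ p.1 ∧ ∀ i, 0 ≤ p.2 i) ∧
          p.1 / b 0 + ∑ i, p.2 i / b i.succ < t} := by
      simp only [Set.ofPred_and, Set.ofPred_forall]
      refine MeasurableSet.inter (MeasurableSet.inter ?_ ?_) ?_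
      · exact measurableSet_le measurable_const measurable_fst
      · exact MeasurableSet.iInter fun i => measurableSet_le measurable_const (by fun_prop)
      · exact measurableSet_lt (by fun_prop) measurable_const
    have hP : 0 < ∏ i : Fin n, b i.succ := Finset.prod_pos fun i _ => hb _
    rw [hS, mp.measure_preimage hm.nullMeasurableSet, Measure.volume_eq_prod,
      Measure.prod_apply hm]
    have key : ∀ s : ℝ, volume (Prod.mk s ⁻¹' {p : ℝ × (Fin n → ℝ) |
        (0 ≤ p.1 ∧ ∀ i, 0 ≤ p.2 i) ∧ p.1 / b 0 + ∑ i, p.2 i / b i.succ < t}) =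
        (Ico 0 (b 0 * t)).indicator (fun s => ENNReal.ofReal
          ((∏ i : Fin n, b i.succ) / n.factorial * (t - s / b 0) ^ n)) s := by
      intro s
      by_cases hs : s ∈ Ico 0 (b 0 * t)
      · rw [indicator_of_mem hs]
        have h1 : s / b 0 < t := by rw [div_lt_iff₀ (hb 0)]; linarith [hs.2]
        have := ih (fun i => b i.succ) (fun i => hb _) (t - s / b 0) (by linarith)
        rw [div_mul_eq_mul_div, ← this]
        congr 1
        ext w
        simp only [mem_preimage, mem_ofPred_eq, hs.1, true_and, lt_sub_iff_add_lt']
      · rw [indicator_of_notMem hs]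
        convert measure_empty (μ := (volume : Measure (Fin n → ℝ)))
        rw [Set.eq_empty_iff_forall_notMem]
        rintro w ⟨⟨h0, h1⟩, h2⟩
        apply hs
        refine ⟨h0, ?_⟩
        have : 0 ≤ ∑ i, w i / b i.succ := Finset.sum_nonneg fun i _ =>
          div_nonneg (h1 i) (hb _).le
        have h3 : s / b 0 < t := by simp only at h2; linarith
        rw [div_lt_iff₀ (hb 0)] at h3; linarith
    rw [lintegral_congr key, lintegral_indicator measurableSet_Ico,
      aux_lint n (b 0) t _ (hb 0) ht (by positivity), Fin.prod_univ_succ, Nat.factorial_succ]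
    congr 1
    push_cast
    field_simp

/-- unit hull set -/
def KK (n : ℕ) : Set ((Fin n → ℝ) × ℝ) :=
  {p | (∀ i, p.1 i ≤ 1) ∧ 0 ≤ p.2 ∧ (∀ i, p.2 ≤ p.1 i) ∧ 1 - p.2 ≤ ∑ i, (1 - p.1 i)}

def GG (n : ℕ) : Set ((Fin n → ℝ) × ℝ) :=
  {p | (∀ i, 0 ≤ p.1 i ∧ p.1 i ≤ 1) ∧ p.2 = ∏ i, p.1 i}

lemma KK_convex (n : ℕ) : Convex ℝ (KK n) := by
  rintro ⟨x, y⟩ ⟨h1, h2, h3, h4⟩ ⟨x', y'⟩ ⟨h1', h2', h3', h4'⟩ a c ha hc hac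
  simp only at h1 h2 h3 h4 h1' h2' h3' h4'
  refine ⟨fun i => ?_, ?_, fun i => ?_, ?_⟩
  · simp; nlinarith [h1 i, h1' i]
  · simp; positivity
  · simp; nlinarith [h3 i, h3' i]
  · have : ∑ i, (1 - (a * x i + c * x' i)) = a * ∑ i, (1 - x i) + c * ∑ i, (1 - x' i) := by
      rw [Finset.mul_sum, Finset.mul_sum, ← Finset.sum_add_distrib]
      refine Finset.sum_congr rfl fun i _ => ?_
      linear_combination (-1 : ℝ) * hac
    simp only [Prod.smul_mk, Prod.mk_add_mk, Pi.add_apply, Pi.smul_apply, smul_eq_mul]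
    rw [this]
    nlinarith

lemma GG_sub (n : ℕ) : GG n ⊆ KK n := by
  rintro ⟨x, y⟩ ⟨h, hy⟩
  simp only at h hy
  subst hy
  have hp : 0 ≤ ∏ i, x i := Finset.prod_nonneg fun i _ => (h i).1
  refine ⟨fun i => (h i).2, hp, fun i => ?_, ?_⟩
  · simp only
    rw [← Finset.mul_prod_erase _ _ (Finset.mem_univ i)]
    exact mul_le_of_le_one_right (h i).1 (Finset.prod_le_one (fun j _ => (h j).1) fun j _ => (h j).2)
  · simp only
    have : ∀ s : Finset (Fin n), 1 - ∏ i ∈ s, x i ≤ ∑ i ∈ s, (1 - x i) := by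
      intro s
      induction s using Finset.induction_on with
      | empty => simp
      | insert a s ha ih =>
        rw [Finset.prod_insert ha, Finset.sum_insert ha]
        have h0 : 0 ≤ ∏ i ∈ s, x i := Finset.prod_nonneg fun i _ => (h i).1
        have h1 : ∏ i ∈ s, x i ≤ 1 := Finset.prod_le_one (fun j _ => (h j).1) fun j _ => (h j).2
        nlinarith [h a]
    exact this _

lemma face_mem (n : ℕ) (x : Fin n → ℝ) (h : ∀ i, 0 ≤ x i ∧ x i ≤ 1) (i : Fin n) (hi : x i = 0) :
    (x, (0 : ℝ)) ∈ convexHull ℝ (GG n) :=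
  subset_convexHull ℝ _ ⟨h, (Finset.prod_eq_zero (Finset.mem_univ i) hi).symm⟩

lemma one_mem' (n : ℕ) : ((fun _ => 1 : Fin n → ℝ), (1 : ℝ)) ∈ convexHull ℝ (GG n) :=
  subset_convexHull ℝ _ ⟨fun i => ⟨zero_le_one, le_rfl⟩, by simp⟩

lemma comb {n : ℕ} {x z w : Fin n → ℝ} {y s r : ℝ} (hz : (z, s) ∈ convexHull ℝ (GG n))
    (hw : (w, r) ∈ convexHull ℝ (GG n)) (a : ℝ) (h0 : 0 ≤ a) (h1 : a ≤ 1)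
    (hx : ∀ i, x i = a * z i + (1 - a) * w i) (hy : y = a * s + (1 - a) * r) :
    (x, y) ∈ convexHull ℝ (GG n) := by
  have := convex_convexHull ℝ (GG n) hz hw h0 (by linarith : 0 ≤ 1 - a) (by ring)
  convert this using 1
  ext i
  · simp [hx]
  · simp [hy]

/-- upper envelope -/
lemma upper_mem (n : ℕ) (x : Fin n → ℝ) (i : Fin n) (h0 : 0 ≤ x i) (hi : ∀ j, x i ≤ x j)
    (h1 : ∀ j, x j ≤ 1) : (x, x i) ∈ convexHull ℝ (GG n) := by
  rcases eq_or_lt_of_le (h1 i) with h | h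
  · have : x = fun _ => 1 := by
      ext j; exact le_antisymm (h1 j) (h ▸ hi j)
    rw [h, this]; exact one_mem' n
  · have hp : 0 < 1 - x i := by linarith
    refine comb (one_mem' n) (face_mem n (fun j => (x j - x i) / (1 - x i)) (fun j => ⟨?_, ?_⟩) i
      (by simp)) (x i) h0 h.le (fun j => ?_) (by ring)
    · exact div_nonneg (by linarith [hi j]) hp.le
    · rw [div_le_one hp]; linarith [h1 j]
    · field_simp; ring

/-- a weighted combination of the vertices adjacent to the all-one vertex -/
lemma simp_mem (n : ℕ) (u : Fin n → ℝ) (h0 : ∀ i, 0 ≤ u i) (h1 : ∑ i, u i = 1) :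
    ((fun i => 1 - u i), (0 : ℝ)) ∈ convexHull ℝ (GG n) := by
  have := (convex_convexHull ℝ (GG n)).sum_mem (t := Finset.univ) (w := u)
    (z := fun i => ((fun j => if j = i then 0 else 1 : Fin n → ℝ), (0 : ℝ)))
    (fun i _ => h0 i) h1 (fun i _ => face_mem n _ (fun j => by split_ifs <;> simp) i (by simp))
  convert this using 1
  ext j
  · simp only [Prod.fst_sum, Prod.smul_mk, Finset.sum_apply, Pi.smul_apply, smul_eq_mul]
    simp [Finset.sum_ite, Finset.filter_ne, Finset.filter_eq, mul_ite, h1]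
  · simp [Prod.snd_sum]

lemma KK_sub (n : ℕ) (hn : 2 ≤ n) : KK n ⊆ convexHull ℝ (GG n) := by
  rintro ⟨x, y⟩ ⟨h1, h2, h3, h4⟩
  simp only at h1 h2 h3 h4
  have : Nonempty (Fin n) := ⟨⟨0, by omega⟩⟩
  obtain ⟨i, hi⟩ := Finite.exists_min x
  have hU := upper_mem n x i (h2.trans (h3 i)) hi h1
  have hL : ∃ l ≤ y, (x, l) ∈ convexHull ℝ (GG n) := by
    set S := ∑ i, (1 - x i) with hS
    have hu0 : ∀ i, 0 ≤ 1 - x i := fun i => by linarith [h1 i]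
    rcases lt_or_ge S 1 with hlt | hge
    · refine ⟨1 - S, by linarith, ?_⟩
      have hS0 : 0 ≤ S := Finset.sum_nonneg fun i _ => hu0 i
      rcases eq_or_lt_of_le hS0 with h | h
      · have := (Finset.sum_eq_zero_iff_of_nonneg fun i _ => hu0 i).1 (hS.symm.trans h.symm)
        have hx : x = fun _ => 1 := by
          ext j; linarith [this j (Finset.mem_univ j)]
        rw [← h, hx, sub_zero]; exact one_mem' n
      · refine comb (simp_mem n (fun i => (1 - x i) / S) (fun i => div_nonneg (hu0 i) h.le)
          (by rw [← Finset.sum_div, ← hS, div_self h.ne'])) (one_mem' n) S h.le hlt.le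
          (fun j => ?_) (by ring)
        field_simp; ring
    · refine ⟨0, h2, ?_⟩
      have hSp : 0 < S := by linarith
      have hxi : 0 ≤ x i := h2.trans (h3 i)
      have hm : 0 < 1 - x i := by
        by_contra hc
        have hall : ∀ j, 1 - x j = 0 := fun j => by linarith [hu0 j, hi j]
        have : S = 0 := by rw [hS]; exact Finset.sum_eq_zero fun j _ => hall j
        linarith
      have A := simp_mem n (fun i => (1 - x i) / S) (fun i => div_nonneg (hu0 i) hSp.le)
          (by rw [← Finset.sum_div, ← hS, div_self hSp.ne'])
      have B := face_mem n (fun j => 1 - (1 - x j) / (1 - x i)) (fun j => ⟨by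
        rw [sub_nonneg, div_le_one hm]; linarith [hi j], by
        linarith [div_nonneg (hu0 j) hm.le]⟩) i (by rw [div_self hm.ne', sub_self])
      rcases eq_or_lt_of_le hge with h | h
      · convert A using 2
        ext j; rw [← h]; ring
      · have hd : 0 < S - (1 - x i) := by linarith
        refine comb A B (S * x i / (S - (1 - x i))) (by positivity) ?_ (fun j => ?_) (by ring)
        · rw [div_le_one hd]; nlinarith
        · field_simp; ring
  obtain ⟨l, hl, hL⟩ := hL
  rcases eq_or_lt_of_le (h3 i) with h | h
  · rw [h]; exact hU
  · have hd : 0 < x i - l := by linarith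
    refine comb hU hL ((y - l) / (x i - l)) (div_nonneg (by linarith) hd.le) ?_ (fun j => by ring) ?_
    · rw [div_le_one hd]; linarith
    · field_simp; ring

lemma hull_eq (n : ℕ) (hn : 2 ≤ n) : convexHull ℝ (GG n) = KK n :=
  Subset.antisymm (convexHull_min (GG_sub n) (KK_convex n)) (KK_sub n hn)

/-- scaling -/
lemma hull_scaled (n : ℕ) (hn : 2 ≤ n) (b : Fin n → ℝ) (hb : ∀ i, 0 < b i) :
    convexHull ℝ {p : (Fin n → ℝ) × ℝ |
        (∀ i, 0 ≤ p.1 i ∧ p.1 i ≤ b i) ∧ p.2 = ∏ i, p.1 i} =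
    {p | ((fun i => p.1 i / b i), p.2 / ∏ i, b i) ∈ KK n} := by
  have hP : 0 < ∏ i, b i := Finset.prod_pos fun i _ => hb i
  let D : ((Fin n → ℝ) × ℝ) →ₗ[ℝ] ((Fin n → ℝ) × ℝ) :=
    { toFun := fun p => ((fun i => b i * p.1 i), (∏ i, b i) * p.2)
      map_add' := fun p q => by ext <;> simp [mul_add]
      map_smul' := fun c p => by ext <;> simp [mul_left_comm] }
  have hD : ∀ s : Set ((Fin n → ℝ) × ℝ),
      D '' s = {p | ((fun i => p.1 i / b i), p.2 / ∏ i, b i) ∈ s} := by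
    intro s
    ext p
    constructor
    · rintro ⟨q, hq, rfl⟩
      have e : ((fun i => (D q).1 i / b i), (D q).2 / ∏ i, b i) = q := by
        refine Prod.ext (funext fun i => ?_) ?_
        · exact mul_div_cancel_left₀ _ (hb i).ne'
        · exact mul_div_cancel_left₀ _ hP.ne'
      rw [mem_ofPred_eq, e]
      exact hq
    · intro h
      refine ⟨_, h, ?_⟩
      refine Prod.ext (funext fun i => ?_) ?_
      · exact mul_div_cancel₀ _ (hb i).ne'
      · exact mul_div_cancel₀ _ hP.ne'
  rw [← hull_eq n hn, ← hD, LinearMap.image_convexHull, hD]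
  congr 1
  ext p
  simp only [GG, mem_ofPred_eq, Finset.prod_div_distrib]
  refine and_congr (forall_congr' fun i => ?_) ?_
  · rw [div_le_one (hb i), le_div_iff₀ (hb i), zero_mul]
  · field_simp

lemma slice_vol (n : ℕ) (b : Fin n → ℝ) (hb : ∀ i, 0 < b i) (t : ℝ) (h0 : 0 ≤ t)
    (h1 : t < 1) :
    volume {x : Fin n → ℝ | ((fun i => x i / b i), t) ∈ KK n} =
      ENNReal.ofReal ((∏ i, b i) * (1 - 1 / n.factorial) * (1 - t) ^ n) := by
  have hP : 0 < ∏ i, b i := Finset.prod_pos fun i _ => hb i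
  have ht : 0 < 1 - t := by linarith
  set T := {w : Fin n → ℝ | (∀ i, 0 ≤ w i) ∧ ∑ i, w i / b i < 1 - t} with hT
  set X := Icc (0 : Fin n → ℝ) (fun i => b i * (1 - t)) with hX
  have hsub : T ⊆ X := by
    rintro w ⟨hw, hs⟩
    refine ⟨hw, fun i => ?_⟩
    have := Finset.single_le_sum (f := fun i => w i / b i)
      (fun i _ => div_nonneg (hw i) (hb i).le) (Finset.mem_univ i)
    have h := this.trans hs.le
    rw [div_le_iff₀ (hb i)] at h
    linarith
  have mp : MeasurePreserving (fun x : Fin n → ℝ => b - x) volume volume :=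
    Measure.measurePreserving_sub_left volume b
  have hE : {x : Fin n → ℝ | ((fun i => x i / b i), t) ∈ KK n} =
      (fun x : Fin n → ℝ => b - x) ⁻¹' (X \ T) := by
    ext x
    have e : ∀ i, (b i - x i) / b i = 1 - x i / b i := fun i => by
      have := (hb i).ne'
      field_simp
    simp only [KK, mem_ofPred_eq, mem_preimage, hX, hT, mem_sdiff, mem_Icc, Pi.le_def,
      Pi.sub_apply, Pi.zero_apply, not_and, not_lt, e]
    have e1 : ∀ i, x i / b i ≤ 1 ↔ 0 ≤ b i - x i := fun i => by
      rw [div_le_one (hb i), sub_nonneg]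
    have e2 : ∀ i, t ≤ x i / b i ↔ b i - x i ≤ b i * (1 - t) := fun i => by
      rw [le_div_iff₀ (hb i)]; constructor <;> intro <;> linarith
    simp only [e1, e2]
    tauto
  have hTm : MeasurableSet T := simplex_meas n b (1 - t)
  rw [hE, mp.measure_preimage (measurableSet_Icc.diff hTm).nullMeasurableSet,
    measure_sdiff hsub hTm.nullMeasurableSet, simplex_vol n b hb _ ht, hX, Real.volume_Icc_pi]
  · simp only [Pi.zero_apply, sub_zero]
    rw [← ENNReal.ofReal_prod_of_nonneg (fun i _ => mul_nonneg (hb i).le ht.le),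
      ← ENNReal.ofReal_sub _ (by positivity), Finset.prod_mul_distrib]
    congr 1
    simp
    ring
  · rw [simplex_vol n b hb _ ht]; exact ENNReal.ofReal_ne_top

/-- The `(n+1)`-dimensional volume of `C_n^0`, the convex hull of the graph of
`x₁⋯xₙ` on `[0,b]`, equals `(∏ᵢ bᵢ²)(n! - 1)/(n+1)!`. -/
theorem volume_Cn0 (n : ℕ) (hn : 2 ≤ n) (b : Fin n → ℝ) (hb : ∀ i, 0 < b i) :
    MeasureTheory.volume
      (convexHull ℝ {p : (Fin n → ℝ) × ℝ |
        (∀ i, 0 ≤ p.1 i ∧ p.1 i ≤ b i) ∧ p.2 = ∏ i, p.1 i}) =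
      ENNReal.ofReal ((∏ i, (b i) ^ 2) * ((n.factorial : ℝ) - 1) /
        ((n + 1).factorial : ℝ)) := by
  have hP : 0 < ∏ i, b i := Finset.prod_pos fun i _ => hb i
  have hf : (1 : ℝ) ≤ n.factorial := by exact_mod_cast Nat.factorial_pos n
  have hm : MeasurableSet {p : (Fin n → ℝ) × ℝ |
      ((fun i => p.1 i / b i), p.2 / ∏ i, b i) ∈ KK n} := by
    simp only [KK, Set.mem_ofPred_eq]
    simp only [Set.ofPred_and, Set.ofPred_forall]
    refine MeasurableSet.inter ?_ (MeasurableSet.inter ?_ (MeasurableSet.inter ?_ ?_))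
    · exact MeasurableSet.iInter fun i => measurableSet_le (by fun_prop) measurable_const
    · exact measurableSet_le measurable_const (by fun_prop)
    · exact MeasurableSet.iInter fun i => measurableSet_le (by fun_prop) (by fun_prop)
    · exact measurableSet_le (by fun_prop) (by fun_prop)
  rw [hull_scaled n hn b hb, Measure.volume_eq_prod, Measure.prod_apply_symm hm]
  have hz : ∀ y : ℝ, volume ((fun x : Fin n → ℝ => (x, y)) ⁻¹' {p : (Fin n → ℝ) × ℝ |
      ((fun i => p.1 i / b i), p.2 / ∏ i, b i) ∈ KK n}) =
      (Icc 0 (∏ i, b i)).indicator (fun y => volume {x : Fin n → ℝ |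
        ((fun i => x i / b i), y / ∏ i, b i) ∈ KK n}) y := by
    intro y
    by_cases hy : y ∈ Icc 0 (∏ i, b i)
    · rw [indicator_of_mem hy]; rfl
    · rw [indicator_of_notMem hy]
      convert measure_empty (μ := (volume : Measure (Fin n → ℝ)))
      rw [Set.eq_empty_iff_forall_notMem]
      rintro x ⟨h1, h2, h3, -⟩
      apply hy
      simp only at h1 h2 h3
      have h4 := (h3 ⟨0, by omega⟩).trans (h1 _)
      rw [div_le_one hP] at h4
      rw [le_div_iff₀ hP, zero_mul] at h2
      exact ⟨h2, h4⟩
  rw [lintegral_congr hz, lintegral_indicator measurableSet_Icc,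
    ← setLIntegral_congr Ico_ae_eq_Icc]
  have hs : ∀ y ∈ Ico 0 (∏ i, b i), volume {x : Fin n → ℝ |
        ((fun i => x i / b i), y / ∏ i, b i) ∈ KK n} =
      ENNReal.ofReal ((∏ i, b i) * (1 - 1 / n.factorial) * (1 - y / ∏ i, b i) ^ n) :=
    fun y hy => slice_vol n b hb _ (div_nonneg hy.1 hP.le) ((div_lt_one hP).2 hy.2)
  rw [setLIntegral_congr_fun measurableSet_Ico hs]
  have hC : 0 ≤ (∏ i, b i) * (1 - 1 / (n.factorial : ℝ)) := by
    refine mul_nonneg hP.le ?_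
    rw [sub_nonneg, div_le_one (by linarith)]; exact hf
  have := aux_lint n (∏ i, b i) 1 _ hP one_pos hC
  rw [mul_one] at this
  rw [this, Nat.factorial_succ, Finset.prod_pow]
  congr 1
  push_cast
  field_simp
  simp
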